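/- arXiv:1902.08007 — 2 statements merged into one kernel-verified Lean document; each statement's English description precedes it below -/
import Mathlib

section
/- Let n ≥ 2, let q be a prime power, and set Δ = 2^{n²−1}·n²·(n+1). Then the number of matrices M ∈ GF(q)^{n×n} all of whose entries are nonzero and which have the property that, for every strong and coverable directed graph D on n vertices, the linear network x ↦ x·(M ⊙ A_D) is expansive, is at least (q−1)^{n²} − Δ·(q−1)^{n²−1}. Here M ⊙ A_D is the Hadamard (entrywise) product of M with the 0/1 adjacency matrix A_D of D. -/
/-- An automata network `f` is *expansive* if for all distinct configurations `x, y`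
and every node `v` there exists `t ≥ 1` with `f^t(x)_v ≠ f^t(y)_v`. -/
def Expansive {n : ℕ} {α : Type*} (f : (Fin n → α) → (Fin n → α)) : Prop :=
  ∀ x y : Fin n → α, x ≠ y → ∀ v : Fin n, ∃ t : ℕ, 1 ≤ t ∧ f^[t] x v ≠ f^[t] y v


section Cycles

open Equiv

variable {V Q K : Type*} [Field K]

theorem Relation.exists_rank_of_reaches {R : Q → Q → Prop} {root : Q}
    (hR : ∀ c, Relation.ReflTransGen R c root) :
    ∃ h : Q → ℕ, ∀ c, c ≠ root → ∃ d, R c d ∧ h d < h c := by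
  let reach : ℕ → Q → Prop := Nat.rec (fun c => c = root) fun _ ih c => ∃ d, R c d ∧ ih d
  have hreach (c : Q) : ∃ k, reach k c := by
    induction hR c using Relation.ReflTransGen.head_induction_on with
    | refl => exact ⟨0, rfl⟩
    | head hab _ ih =>
      obtain ⟨k, hk⟩ := ih
      exact ⟨k + 1, _, hab, hk⟩
  refine ⟨fun c => sInf {k | reach k c}, fun c hc => ?_⟩
  have hmem : reach (sInf {k | reach k c}) c := Nat.sInf_mem (hreach c)
  rcases hk : sInf {k | reach k c} with _ | k
  · rw [hk] at hmem
    exact absurd hmem hc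
  · rw [hk] at hmem
    obtain ⟨d, hcd, hd⟩ := hmem
    refine ⟨d, hcd, ?_⟩
    simp only [hk]
    exact Nat.lt_succ_of_le (Nat.sInf_le hd)

/-- Eigenvectors of a forest of weighted cycles: if the arcs `u c ⟶ w c` lead from every cycle
other than `root` to a cycle of smaller rank, and the cycles have pairwise disjoint spectra,
then every eigenvector has nonzero eigenvalue and is supported on the whole root cycle. -/
theorem eigenvector_ne_zero_on_root [Fintype Q] (π : Perm V) (o : V → Q)
    (hoπ : ∀ i, o (π i) = o i) (ho : ∀ i j, o i = o j → ∃ k : ℕ, (π ^ k) i = j)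
    (b : Q → K) (hb : ∀ c, b c ≠ 0) (L : ℕ) (hL : L ≠ 0) (hπL : π ^ L = 1)
    (hbL : Function.Injective fun c => b c ^ L) (root : Q) (u w : Q → V)
    (hu : ∀ c, o (u c) = c) (h : Q → ℕ) (hh : ∀ c, c ≠ root → h (o (w c)) < h c)
    (x : V → K) (hx : x ≠ 0) (μ : K)
    (hE : ∀ i, μ * x (π i) =
      b (o i) * x i + ∑ c, open Classical in if c ≠ root ∧ w c = π i then x (u c) else 0) :
    μ ≠ 0 ∧ ∀ i, o i = root → x i ≠ 0 := by
  classical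
  let Z : Q → Prop := fun c => ∀ i, o i = c → x i = 0
  have hpow : ∀ (k : ℕ) i, o ((π ^ k) i) = o i := by
    intro k i
    induction k with
    | zero => rfl
    | succ k ih => rw [pow_succ', Perm.mul_apply, hoπ, ih]
  have source : ∀ c, (∀ d, d ≠ root → o (w d) = c → Z d) → ¬ Z c →
      μ ^ L = b c ^ L ∧ ∀ i, o i = c → x i ≠ 0 := by
    intro c hc hZ
    have hstep : ∀ i, o i = c → μ * x (π i) = b c * x i := by
      intro i hi
      rw [hE i, hi, Finset.sum_eq_zero, add_zero]
      intro d _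
      split_ifs with hd
      · exact hc d hd.1 (by rw [hd.2, hoπ, hi]) _ (hu d)
      · rfl
    have hiter : ∀ (k : ℕ) i, o i = c → μ ^ k * x ((π ^ k) i) = b c ^ k * x i := by
      intro k i hi
      induction k with
      | zero => simp
      | succ k ih =>
        have := hstep ((π ^ k) i) (by rw [hpow, hi])
        rw [pow_succ' π, Perm.mul_apply, pow_succ, mul_assoc, this, mul_left_comm, ih, pow_succ]
        ring
    simp only [Z, not_forall] at hZ
    obtain ⟨i, hi, hxi⟩ := hZ
    refine ⟨?_, fun j hj hxj => ?_⟩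
    · have := hiter L i hi
      rw [hπL] at this
      exact mul_right_cancel₀ hxi this
    · obtain ⟨k, rfl⟩ := ho i j (hi.trans hj.symm)
      have := hiter k i hi
      rw [hxj, mul_zero] at this
      exact mul_ne_zero (pow_ne_zero _ (hb c)) hxi this.symm
  have relay : μ ≠ 0 → ∀ c, c ≠ root → (∀ i, o i = c → x i ≠ 0) →
      (∀ d, d ≠ root → o (w d) = o (w c) → d ≠ c → Z d) →
      ∀ i, o i = o (w c) → x i ≠ 0 := by
    intro hμ c hc hfull hd
    have hstep : ∀ i, o i = o (w c) →
        μ * x (π i) = b (o i) * x i + if w c = π i then x (u c) else 0 := by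
      intro i hi
      rw [hE i, Finset.sum_eq_single c]
      · simp [hc]
      · intro d _ hdc
        split_ifs with hd'
        · exact hd d hd'.1 (by rw [hd'.2, hoπ, hi]) hdc _ (hu d)
        · rfl
      · simp
    by_cases ha : x (w c) = 0
    · have hzero : ∀ k : ℕ, x ((π ^ k) (w c)) = 0 := by
        intro k
        induction k with
        | zero => exact ha
        | succ k ih =>
          have := hstep ((π ^ k) (w c)) (hpow _ _)
          rw [pow_succ', Perm.mul_apply]
          split_ifs at this with hw
          · rw [← hw, ha]
          · rw [ih, mul_zero, add_zero] at this
            exact (mul_eq_zero.1 this).resolve_left hμ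
      have ho' : o (π.symm (w c)) = o (w c) := by
        rw [← hoπ (π.symm (w c)), Equiv.apply_symm_apply]
      obtain ⟨k, hk⟩ := ho (w c) (π.symm (w c)) ho'.symm
      have := hstep (π.symm (w c)) ho'
      rw [← hk, hzero k, hk, Equiv.apply_symm_apply, ha] at this
      simp only [mul_zero, if_true, zero_add] at this
      exact absurd this.symm (hfull _ (hu c))
    · have hne : ∀ k : ℕ, x ((π ^ k) (w c)) ≠ 0 := by
        intro k
        induction k with
        | zero => exact ha
        | succ k ih =>
          have := hstep ((π ^ k) (w c)) (hpow _ _)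
          rw [pow_succ', Perm.mul_apply]
          split_ifs at this with hw
          · rwa [← hw]
          · intro h0
            rw [h0, mul_zero, add_zero] at this
            exact mul_ne_zero (hb _) ih this.symm
      intro i hi
      obtain ⟨k, rfl⟩ := ho (w c) i hi.symm
      exact hne k
  obtain ⟨c₀, hc₀Z, hc₀⟩ : ∃ c₀, ¬ Z c₀ ∧ ∀ d, ¬ Z d → h d ≤ h c₀ := by
    obtain ⟨i, hi⟩ := Function.ne_iff.1 hx
    obtain ⟨c₀, hc₀, hmax⟩ := (Finset.univ.filter fun c => ¬ Z c).exists_max_image h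
      ⟨o i, by simpa using fun hZ : Z (o i) => hi (hZ i rfl)⟩
    exact ⟨c₀, by simpa using hc₀, fun d hd => hmax d (by simpa using hd)⟩
  obtain ⟨hμL, hfull₀⟩ := source c₀ (fun d hd hdc => by
    by_contra hZ
    have := hh d hd
    rw [hdc] at this
    exact (hc₀ d hZ).not_gt this) hc₀Z
  have hμ : μ ≠ 0 := by
    rintro rfl
    rw [zero_pow hL] at hμL
    exact pow_ne_zero L (hb c₀) hμL.symm
  let R : Q → Q → Prop := fun c d => c ≠ root ∧ o (w c) = d
  have hmono : ∀ {c d}, Relation.ReflTransGen R c d → h d ≤ h c := by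
    intro c d hcd
    induction hcd with
    | refl => exact le_rfl
    | tail _ hab ih => exact (hab.2 ▸ (hh _ hab.1).le).trans ih
  have off_chain : ∀ c, ¬ Relation.ReflTransGen R c₀ c → Z c := by
    by_contra! hne
    obtain ⟨c, hc, hmax⟩ := (Finset.univ.filter fun c =>
      ¬ Relation.ReflTransGen R c₀ c ∧ ¬ Z c).exists_max_image h
      (by obtain ⟨c, hc⟩ := hne; exact ⟨c, by simpa using hc⟩)
    simp only [Finset.mem_filter, Finset.mem_univ, true_and] at hc hmax
    obtain ⟨hcL, -⟩ := source c (fun d hd hdc => by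
      by_contra hZ
      have := hmax d ⟨fun hcd => hc.1 (hcd.tail ⟨hd, hdc⟩), hZ⟩
      have := hh d hd
      rw [hdc] at this
      omega) hc.2
    exact hc.1 (hbL (hμL.symm.trans hcL) ▸ .refl)
  have on_chain : ∀ c, Relation.ReflTransGen R c₀ c → ∀ i, o i = c → x i ≠ 0 := by
    intro c hc
    induction hc with
    | refl => exact hfull₀
    | @tail c c' hcc hstep ih =>
      obtain ⟨hcr, rfl⟩ := hstep
      refine relay hμ c hcr ih fun d hd hdc hne => off_chain d fun hcd => ?_
      have hU : Relator.RightUnique R := fun _ _ _ h₁ h₂ => h₁.2.symm.trans h₂.2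
      have key : ∀ {a e}, a ≠ e → e ≠ root → o (w e) = o (w a) →
          ¬ Relation.ReflTransGen R a e := by
        intro a e hae he hwe hae'
        rcases hae'.cases_head with rfl | ⟨f, ⟨-, rfl⟩, hf⟩
        · exact hae rfl
        · have h₁ := hmono hf
          have h₂ := hh e he
          rw [hwe] at h₂
          omega
      rcases Relation.ReflTransGen.total_of_right_unique hU hcc hcd with hcd | hdc'
      · exact key hne.symm hd hdc hcd
      · exact key hne hcr hdc.symm hdc'
  have hroot : ∀ (k : ℕ) c, h c = k → Relation.ReflTransGen R c root := by
    intro k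
    induction k using Nat.strong_induction_on with
    | _ k ih =>
      rintro c rfl
      by_cases hc : c = root
      · exact hc ▸ .refl
      · exact (ih _ (hh c hc) _ rfl).head ⟨hc, rfl⟩
  exact ⟨hμ, on_chain root (hroot _ _ rfl)⟩

theorem IsAlgClosed.exists_injective_pow [Finite Q] [IsAlgClosed K] {L : ℕ} (hL : 0 < L) :
    ∃ b : Q → K, (∀ c, b c ≠ 0) ∧ Function.Injective fun c => b c ^ L := by
  have : Infinite ({0}ᶜ : Set K) := (Set.finite_singleton (0 : K)).infinite_compl.to_subtype
  obtain ⟨e, he⟩ := Countable.exists_injective_nat Q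
  choose b hb using fun c => IsAlgClosed.exists_pow_nat_eq
    (Infinite.natEmbedding ({0}ᶜ : Set K) (e c) : K) hL
  refine ⟨b, fun c hc => ?_, fun c d hcd => ?_⟩
  · have := hb c
    rw [hc, zero_pow hL.ne'] at this
    exact (Infinite.natEmbedding ({0}ᶜ : Set K) (e c)).2 this.symm
  · simp only [hb] at hcd
    exact he ((Infinite.natEmbedding _).injective (Subtype.ext hcd))

/-- A strong and coverable digraph carries a weight matrix which is invertible and observable
at `v`, in the form of the Popov–Belevitch–Hautus eigenvector test. -/
theorem exists_weights_eigenvector_ne_zero [Fintype V] [IsAlgClosed K] {r : V → V → Prop}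
    (hr : ∀ a b, Relation.ReflTransGen r a b) (π : Perm V) (hπ : ∀ a, r a (π a)) (v : V) :
    ∃ N : Matrix V V K, (∀ i j, N i j ≠ 0 → r i j) ∧
      ∀ (x : V → K) (μ : K), x ≠ 0 → Matrix.vecMul x N = μ • x → μ ≠ 0 ∧ x v ≠ 0 := by
  classical
  let Q := Quotient (Perm.SameCycle.setoid π)
  let o : V → Q := Quotient.mk _
  have hoπ : ∀ i, o (π i) = o i := fun i => Quotient.sound (Perm.sameCycle_apply_left.2 (.refl _ _))
  have ho : ∀ i j, o i = o j → ∃ k : ℕ, (π ^ k) i = j := fun i j hij =>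
    (Quotient.exact hij : π.SameCycle i j).exists_nat_pow_eq
  obtain ⟨h, hh⟩ := Relation.exists_rank_of_reaches
    (R := fun c d => ∃ a b, r a b ∧ o a = c ∧ o b = d) (root := o v) (fun c => by
      obtain ⟨a, rfl⟩ := Quotient.exists_rep c
      exact (hr a v).lift o fun a b hab => ⟨a, b, hab, rfl, rfl⟩)
  have hex : ∀ c, ∃ a b, o a = c ∧ (c ≠ o v → r a b ∧ h (o b) < h c) := by
    intro c
    by_cases hc : c = o v
    · exact ⟨v, v, hc.symm, fun h => absurd hc h⟩
    · obtain ⟨_, ⟨a, b, hab, ha, rfl⟩, hlt⟩ := hh c hc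
      exact ⟨a, b, ha, fun _ => ⟨hab, hlt⟩⟩
  choose u w hu huw using hex
  obtain ⟨b, hb, hbL⟩ := IsAlgClosed.exists_injective_pow (Q := Q) (K := K) (orderOf_pos π)
  refine ⟨Matrix.of fun i j => (if j = π i then b (o i) else 0) +
    ∑ c, if c ≠ o v ∧ w c = j then (if i = u c then 1 else 0) else 0, fun i j hij => ?_,
    fun x μ hx hxμ => ?_⟩
  · by_contra hrij
    refine hij ?_
    rw [Matrix.of_apply, if_neg (by rintro rfl; exact hrij (hπ i)), zero_add]
    refine Finset.sum_eq_zero fun c _ => ?_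
    split_ifs with h₁ h₂
    · exact absurd (huw c h₁.1).1 (by rwa [h₁.2, ← h₂])
    all_goals rfl
  · have := eigenvector_ne_zero_on_root π o hoπ ho b hb (orderOf π) (orderOf_pos π).ne'
      (pow_orderOf_eq_one π) hbL (o v) u w hu h (fun c hc => (huw c hc).2) x hx μ ?_
    · exact ⟨this.1, this.2 v rfl⟩
    · intro i
      have hi := congrFun hxμ (π i)
      rw [Pi.smul_apply, smul_eq_mul] at hi
      rw [← hi]
      simp only [Matrix.vecMul, dotProduct, Matrix.of_apply, mul_add, Finset.sum_add_distrib,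
        Finset.mul_sum]
      congr 1
      · simp [mul_comm]
      · rw [Finset.sum_comm]
        refine Finset.sum_congr rfl fun c _ => ?_
        split_ifs <;> simp

end Cycles

section Observability

open MvPolynomial

variable {n : ℕ} {R S K : Type*} [CommRing R] [CommRing S] [Field K]

/-- The observability matrix of `x ↦ x N` at the node `v`: its columns are the `v`-th columns
of `N, N², …, Nⁿ`. -/
def obsMatrix (N : Matrix (Fin n) (Fin n) R) (v : Fin n) : Matrix (Fin n) (Fin n) R :=
  Matrix.of fun i t => (N ^ ((t : ℕ) + 1)) i v

theorem vecMul_obsMatrix (N : Matrix (Fin n) (Fin n) R) (v : Fin n) (x : Fin n → R) (t : Fin n) :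
    Matrix.vecMul x (obsMatrix N v) t = Matrix.vecMul x (N ^ ((t : ℕ) + 1)) v := rfl

theorem map_det_obsMatrix (f : R →+* S) (N : Matrix (Fin n) (Fin n) R) (v : Fin n) :
    f (obsMatrix N v).det = (obsMatrix (N.map f) v).det := by
  rw [RingHom.map_det]
  congr 1
  ext i t
  have h := map_pow f.mapMatrix N ((t : ℕ) + 1)
  simp only [RingHom.mapMatrix_apply] at h
  simp only [RingHom.mapMatrix_apply, obsMatrix, Matrix.map_apply, Matrix.of_apply, ← h]

theorem det_obsMatrix_ne_zero [IsAlgClosed K] {N : Matrix (Fin n) (Fin n) K} {v : Fin n}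
    (hN : ∀ (x : Fin n → K) (μ : K), x ≠ 0 → Matrix.vecMul x N = μ • x → μ ≠ 0 ∧ x v ≠ 0) :
    (obsMatrix N v).det ≠ 0 := by
  intro hdet
  obtain ⟨x, hx, hxN⟩ := Matrix.exists_vecMul_eq_zero_iff.2 hdet
  let φ : (Fin n → K) → Matrix (Fin n) (Fin n) K →ₗ[K] K := fun y =>
    { toFun := fun A => Matrix.vecMul y (A * N) v
      map_add' := fun A B => by simp [add_mul, Matrix.vecMul_add]
      map_smul' := fun c A => by simp [Matrix.vecMul_smul] }
  have hφ : ∀ y A, φ y A = Matrix.vecMul y (A * N) v := fun _ _ => rfl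
  have hlow : ∀ t < n, φ x (N ^ t) = 0 := fun t ht => by
    rw [hφ, ← pow_succ]
    exact congrFun hxN ⟨t, ht⟩
  have hn : 0 < n := v.pos
  have hdeg : N.charpoly.natDegree = n := by simp
  have hall : ∀ t, φ x (N ^ t) = 0 := fun t => by
    rw [Matrix.pow_eq_aeval_mod_charpoly, Polynomial.aeval_eq_sum_range' (n := n), map_sum]
    · refine Finset.sum_eq_zero fun i hi => ?_
      rw [map_smul, hlow i (Finset.mem_range.1 hi), smul_zero]
    · have := Polynomial.natDegree_modByMonic_lt (Polynomial.X ^ t) N.charpoly_monic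
        (fun h => by rw [h, Polynomial.natDegree_one] at hdeg; omega)
      rwa [hdeg] at this
  let U : Submodule K (Fin n → K) :=
    { carrier := {y | ∀ t, φ y (N ^ t) = 0}
      add_mem' := fun {y z} hy hz t => by
        have h₁ := hy t
        have h₂ := hz t
        rw [hφ] at *
        rw [Matrix.add_vecMul, Pi.add_apply, h₁, h₂, add_zero]
      zero_mem' := fun t => by simp [hφ]
      smul_mem' := fun c y hy t => by
        have h := hy t
        rw [hφ] at *
        rw [Matrix.smul_vecMul, Pi.smul_apply, h, smul_zero] }
  have hU : ∀ y ∈ U, N.vecMulLinear y ∈ U := fun y hy t => by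
    have h := hy (t + 1)
    rw [hφ] at *
    rwa [Matrix.vecMulLinear_apply, Matrix.vecMul_vecMul, ← mul_assoc, ← pow_succ']
  have : Nontrivial U := ⟨⟨⟨x, hall⟩, 0, fun h => hx (congrArg Subtype.val h)⟩⟩
  obtain ⟨μ, hμ⟩ := Module.End.exists_eigenvalue (N.vecMulLinear.restrict hU)
  obtain ⟨y, hy⟩ := hμ.exists_hasEigenvector
  have hyN : Matrix.vecMul (y : Fin n → K) N = μ • (y : Fin n → K) :=
    congrArg Subtype.val hy.apply_eq_smul
  obtain ⟨hμ0, hyv⟩ := hN y μ (fun h => hy.2 (Subtype.ext h)) hyN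
  have h0 : φ y (N ^ 0) = 0 := y.2 0
  rw [hφ, pow_zero, one_mul, hyN] at h0
  exact mul_ne_zero hμ0 hyv h0

theorem expansive_vecMul {N : Matrix (Fin n) (Fin n) K} (hN : ∀ v, (obsMatrix N v).det ≠ 0) :
    Expansive fun x => Matrix.vecMul x N := by
  intro x y hxy v
  have hiter : ∀ (t : ℕ) (z : Fin n → K),
      (fun x => Matrix.vecMul x N)^[t] z = Matrix.vecMul z (N ^ t) := by
    intro t
    induction t with
    | zero => simp
    | succ t ih =>
      intro z
      rw [Function.iterate_succ_apply, ih, Matrix.vecMul_vecMul, ← pow_succ']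
  by_contra! h
  refine hN v (Matrix.exists_vecMul_eq_zero_iff.1 ⟨x - y, sub_ne_zero.2 hxy, ?_⟩)
  ext t
  rw [vecMul_obsMatrix, Matrix.sub_vecMul, Pi.sub_apply, ← hiter, ← hiter,
    h _ (Nat.le_add_left 1 _), sub_self, Pi.zero_apply]

theorem totalDegree_pow_apply_le {σ : Type*} {N : Matrix (Fin n) (Fin n) (MvPolynomial σ R)}
    (hN : ∀ i j, (N i j).totalDegree ≤ 1) (t : ℕ) (i j : Fin n) :
    ((N ^ t) i j).totalDegree ≤ t := by
  induction t generalizing j with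
  | zero =>
    rw [pow_zero, Matrix.one_apply]
    split_ifs <;> simp
  | succ t ih =>
    rw [pow_succ, Matrix.mul_apply]
    exact totalDegree_finsetSum_le fun k _ =>
      (totalDegree_mul _ _).trans (add_le_add (ih k) (hN k j))

theorem totalDegree_det_obsMatrix_le {σ : Type*}
    {N : Matrix (Fin n) (Fin n) (MvPolynomial σ R)} (hN : ∀ i j, (N i j).totalDegree ≤ 1)
    (v : Fin n) : (obsMatrix N v).det.totalDegree ≤ ∑ t : Fin n, ((t : ℕ) + 1) := by
  rw [Matrix.det_apply]
  refine totalDegree_finsetSum_le fun p _ => ?_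
  rw [Units.smul_def, ← Int.cast_smul_eq_zsmul R]
  refine (totalDegree_smul_le _ _).trans ((totalDegree_finsetProd _ _).trans ?_)
  exact Finset.sum_le_sum fun t _ => totalDegree_pow_apply_le hN _ _ _

/-- The generic matrix supported on the arcs of `D`. -/
noncomputable def genericMatrix (R : Type*) [CommRing R] (D : Fin n → Fin n → Bool) :
    Matrix (Fin n) (Fin n) (MvPolynomial (Fin n × Fin n) R) :=
  Matrix.of fun i j => X (i, j) * if D i j then 1 else 0

theorem totalDegree_genericMatrix_le (D : Fin n → Fin n → Bool) (i j : Fin n) :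
    (genericMatrix R D i j).totalDegree ≤ 1 := by
  rw [genericMatrix, Matrix.of_apply]
  split_ifs
  · rw [mul_one]
    exact (totalDegree_monomial_le _ _).trans (by simp)
  · simp

theorem det_obsMatrix_genericMatrix_ne_zero {D : Fin n → Fin n → Bool}
    (hD : ∀ u v : Fin n, Relation.ReflTransGen (fun a b => D a b = true) u v)
    (hcov : ∃ π : Equiv.Perm (Fin n), ∀ v : Fin n, D v (π v) = true) (v : Fin n) :
    (obsMatrix (genericMatrix K D) v).det ≠ 0 := by
  intro hzero
  obtain ⟨π, hπ⟩ := hcov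
  obtain ⟨N, hND, hN⟩ := exists_weights_eigenvector_ne_zero (K := AlgebraicClosure K) hD π hπ v
  refine det_obsMatrix_ne_zero hN ?_
  have := map_det_obsMatrix
    (aeval (R := K) fun e : Fin n × Fin n => N e.1 e.2).toRingHom (genericMatrix K D) v
  rw [hzero, map_zero] at this
  rw [this]
  congr 2
  ext i j
  by_cases hij : D i j = true
  · simp [genericMatrix, hij]
  · have : N i j = 0 := by
      by_contra h
      exact hij (hND i j h)
    simp [genericMatrix, hij, this]

end Observability

theorem MvPolynomial.card_filter_eval_eq_zero_le {σ R : Type*} [Fintype σ] [DecidableEq σ]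
    [Nonempty σ] [CommRing R] [IsDomain R] [DecidableEq R] {p : MvPolynomial σ R} (hp : p ≠ 0)
    (S : Finset R) :
    ((Fintype.piFinset fun _ : σ => S).filter fun f => eval f p = 0).card ≤
      p.totalDegree * S.card ^ (Fintype.card σ - 1) := by
  have e := Fintype.equivFin σ
  have hcard : 0 < Fintype.card σ := Fintype.card_pos
  rcases S.eq_empty_or_nonempty with rfl | hS
  · simp
  have hpos : (0 : ℚ≥0) < S.card := by exact_mod_cast hS.card_pos
  have hsz := schwartz_zippel_totalDegree
    ((map_ne_zero_iff _ (rename_injective e e.injective)).2 hp) S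
  have hle : ((Fintype.piFinset fun _ : σ => S).filter fun f => eval f p = 0).card ≤
      ((Fintype.piFinset fun _ : Fin (Fintype.card σ) => S).filter
        fun f => eval f (rename e p) = 0).card := by
    refine Finset.card_le_card_of_injOn (fun f => f ∘ e.symm) (fun f hf => ?_) fun f _ g _ h => ?_
    · simp only [Finset.coe_filter, Fintype.mem_piFinset, Set.mem_ofPred_eq] at hf ⊢
      refine ⟨fun i => hf.1 _, ?_⟩
      rw [eval_rename, Function.comp_assoc, e.symm_comp_self, Function.comp_id]
      exact hf.2
    · exact e.symm.surjective.injective_comp_right h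
  have hdeg : (rename e p).totalDegree ≤ p.totalDegree := totalDegree_rename_le _ _
  rw [div_le_div_iff₀ (by positivity) hpos] at hsz
  norm_cast at hsz
  refine hle.trans (Nat.le_of_mul_le_mul_right ?_ hS.card_pos)
  rw [mul_assoc, ← pow_succ, Nat.sub_add_cancel hcard]
  exact hsz.trans (Nat.mul_le_mul_right _ hdeg)

/-- Corollary (Random-Linear-Strategy): let `F` be a finite field of order `q` and
`Δ = 2^{n²-1} n² (n+1)`. The number of matrices `M ∈ F^{n×n}` with all entries
nonzero such that for *every* strong and coverable directed graph `D` on `n` vertices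
the linear network `x ↦ x (M ⊙ A_D)` is expansive (where `⊙` is the entrywise
product with the 0/1 adjacency matrix of `D`) is at least
`(q-1)^{n²} - Δ (q-1)^{n²-1}`. -/
theorem stmt_6 (n : ℕ) (hn : 2 ≤ n) (F : Type) [Field F] [Fintype F] :
    (Fintype.card F - 1) ^ (n ^ 2) -
        (2 ^ (n ^ 2 - 1) * n ^ 2 * (n + 1)) * (Fintype.card F - 1) ^ (n ^ 2 - 1) ≤
      Nat.card {M : Matrix (Fin n) (Fin n) F //
        (∀ i j : Fin n, M i j ≠ 0) ∧
        ∀ D : Fin n → Fin n → Bool,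
          (∀ u v : Fin n, Relation.ReflTransGen (fun a b => D a b = true) u v) →
          (∃ π : Equiv.Perm (Fin n), ∀ v : Fin n, D v (π v) = true) →
          Expansive (fun x => Matrix.vecMul x
            (Matrix.of fun i j => M i j * (if D i j then 1 else 0)))} := by
  classical
  let good : Finset (Fin n → Fin n → Bool) := Finset.univ.filter fun D =>
    (∀ u v : Fin n, Relation.ReflTransGen (fun a b => D a b = true) u v) ∧
      ∃ π : Equiv.Perm (Fin n), ∀ v : Fin n, D v (π v) = true
  let P : MvPolynomial (Fin n × Fin n) F :=
    ∏ D ∈ good, ∏ v, (obsMatrix (genericMatrix F D) v).det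
  have hP : P ≠ 0 := Finset.prod_ne_zero_iff.2 fun D hD => Finset.prod_ne_zero_iff.2 fun v _ => by
    have hD' := (Finset.mem_filter.1 hD).2
    exact det_obsMatrix_genericMatrix_ne_zero hD'.1 hD'.2 v
  have hsum : 2 * ∑ t : Fin n, ((t : ℕ) + 1) = n * (n + 1) := by
    rw [Fin.sum_univ_eq_sum_range (fun t => t + 1) n]
    clear * -
    induction n with
    | zero => rfl
    | succ n ih => rw [Finset.sum_range_succ, mul_add, ih]; ring
  have hdeg : P.totalDegree ≤ 2 ^ (n ^ 2 - 1) * n ^ 2 * (n + 1) := by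
    calc P.totalDegree ≤ ∑ D ∈ good, ∑ v : Fin n, ∑ t : Fin n, ((t : ℕ) + 1) :=
          (MvPolynomial.totalDegree_finsetProd _ _).trans <| Finset.sum_le_sum fun D _ =>
            (MvPolynomial.totalDegree_finsetProd _ _).trans <| Finset.sum_le_sum fun v _ =>
              totalDegree_det_obsMatrix_le (totalDegree_genericMatrix_le D) v
      _ ≤ 2 ^ (n ^ 2) * (n * ∑ t : Fin n, ((t : ℕ) + 1)) := by
          rw [Finset.sum_const, Finset.sum_const, smul_eq_mul, smul_eq_mul, Finset.card_univ,
            Fintype.card_fin]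
          refine Nat.mul_le_mul_right _ ((Finset.card_le_univ _).trans ?_)
          simp [← pow_mul, sq]
      _ = 2 ^ (n ^ 2 - 1) * (n * (2 * ∑ t : Fin n, ((t : ℕ) + 1))) := by
          obtain ⟨m, hm⟩ : ∃ m, n ^ 2 = m + 1 := Nat.exists_eq_succ_of_ne_zero (by positivity)
          rw [hm, Nat.add_sub_cancel, pow_succ]
          ring
      _ = _ := by rw [hsum]; ring
  let S : Finset F := Finset.univ.erase 0
  have hS : S.card = Fintype.card F - 1 := by
    rw [Finset.card_erase_of_mem (Finset.mem_univ _), Finset.card_univ]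
  have : NeZero n := ⟨by omega⟩
  have hbad := MvPolynomial.card_filter_eval_eq_zero_le hP S
  have hall : (Fintype.piFinset fun _ : Fin n × Fin n => S).card =
      (Fintype.card F - 1) ^ (n ^ 2) := by
    rw [Fintype.card_piFinset, Finset.prod_const, hS, Finset.card_univ, Fintype.card_prod,
      Fintype.card_fin, sq]
  rw [hS, Fintype.card_prod, Fintype.card_fin, ← sq] at hbad
  have hsplit := Finset.card_filter_add_card_filter_not
    (s := Fintype.piFinset fun _ : Fin n × Fin n => S) fun f => MvPolynomial.eval f P = 0
  have hgood : ((Fintype.piFinset fun _ : Fin n × Fin n => S).filter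
      fun f => ¬ MvPolynomial.eval f P = 0).card ≤
      Nat.card {M : Matrix (Fin n) (Fin n) F //
        (∀ i j : Fin n, M i j ≠ 0) ∧
        ∀ D : Fin n → Fin n → Bool,
          (∀ u v : Fin n, Relation.ReflTransGen (fun a b => D a b = true) u v) →
          (∃ π : Equiv.Perm (Fin n), ∀ v : Fin n, D v (π v) = true) →
          Expansive (fun x => Matrix.vecMul x
            (Matrix.of fun i j => M i j * (if D i j then 1 else 0)))} := by
    rw [← Fintype.card_coe, ← Nat.card_eq_fintype_card]
    refine Nat.card_le_card_of_injective
      (fun f => ⟨Matrix.of fun i j => f.1 (i, j), ?_, ?_⟩) ?_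
    · intro i j
      have := (Finset.mem_filter.1 f.2).1
      exact Finset.ne_of_mem_erase (Fintype.mem_piFinset.1 this (i, j))
    · intro D hD hcov
      refine expansive_vecMul fun v hv => (Finset.mem_filter.1 f.2).2 ?_
      rw [map_prod]
      refine Finset.prod_eq_zero (i := D) (Finset.mem_filter.2 ⟨Finset.mem_univ _, hD, hcov⟩) ?_
      rw [map_prod]
      refine Finset.prod_eq_zero (Finset.mem_univ v) ?_
      rw [map_det_obsMatrix]
      refine Eq.trans ?_ hv
      congr 2
      ext i j
      by_cases hij : D i j = true <;> simp [genericMatrix, hij]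
    · intro f g hfg
      ext e
      exact congrFun (congrFun (congrArg Subtype.val hfg) e.1) e.2
  refine le_trans ?_ hgood
  have := hbad.trans (Nat.mul_le_mul_right _ hdeg)
  omega
end

section
/- Let D be a strong and coverable directed graph on n ≥ 2 vertices. Then there exists a positive integer Q such that for every positive multiple q of Q there exists an expansive automata network f : [q]^n → [q]^n whose interaction graph is D. In particular, the set of alphabet sizes q for which D admits an expansive network has positive natural density. -/
/-- Arc `u → v` of the interaction graph of the automata network `f`:
`f_v` depends essentially on coordinate `u`. -/
def hasArc {n : ℕ} {α : Type*} (f : (Fin n → α) → (Fin n → α)) (u v : Fin n) : Prop :=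
  ∃ a b : Fin n → α, (∀ w : Fin n, w ≠ u → a w = b w) ∧ f a v ≠ f b v

section Observability

variable {V K : Type*} [Fintype V] [DecidableEq V] [Field K]

/-- `(A, v)` is observable on the vertex set `S`: no eigenvector of the restriction of `A` to `S`
vanishes at `v`, and, for all but finitely many `μ`, neither does any solution of
`(μ - A) x = r e_s` with `s ∈ S` and `r ≠ 0`. -/
structure ObservableOn (A : Matrix V V K) (v : V) (S : Set V) : Prop where
  eigenvector : ∀ (μ : K) (x : V → K), (∀ w, w ∉ S → x w = 0) →
    (∀ w ∈ S, μ * x w = ∑ u, A w u * x u) → x ≠ 0 → x v ≠ 0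
  resolvent : ∃ B : Finset K, ∀ μ, μ ∉ B → ∀ s ∈ S, ∀ r : K, r ≠ 0 → ∀ x : V → K,
    (∀ w, w ∉ S → x w = 0) →
    (∀ w ∈ S, μ * x w = ∑ u, A w u * x u + if w = s then r else 0) → x v ≠ 0

omit [DecidableEq V] in
lemma Equiv.Perm.SameCycle.induction_forward {π : Equiv.Perm V} {a b : V} {P : V → Prop}
    (hab : π.SameCycle a b) (ha : P a) (hs : ∀ w, π.SameCycle a w → P w → P (π w)) : P b := by
  obtain ⟨k, rfl⟩ := hab.exists_nat_pow_eq
  clear hab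
  induction k with
  | zero => simpa using ha
  | succ k ih =>
    rw [pow_succ', Equiv.Perm.mul_apply]
    exact hs _ ⟨k, by simp⟩ ih

omit [DecidableEq V] in
lemma Equiv.Perm.SameCycle.induction_backward {π : Equiv.Perm V} {a b : V} {P : V → Prop}
    (hab : π.SameCycle a b) (hb : P b) (hs : ∀ w, π.SameCycle a w → P (π w) → P w) : P a := by
  by_contra ha
  exact hab.induction_forward (P := fun w => ¬ P w) ha (fun w hw h h' => h (hs w hw h')) hb

omit [DecidableEq V] in
lemma eq_zero_on_cycle {π : Equiv.Perm V} {μ ν : K} (hν : ν ≠ 0) {x : V → K} {a : V}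
    (hx : ∀ w, π.SameCycle a w → μ * x (π w) = ν * x w) (ha : x a = 0) {b : V}
    (hab : π.SameCycle a b) : x b = 0 := by
  refine hab.symm.induction_backward (P := fun w => x w = 0) ha fun w hw h => ?_
  have := hx w (hab.trans hw)
  rw [h, mul_zero] at this
  exact (mul_eq_zero.1 this.symm).resolve_left hν

omit [Fintype V] [DecidableEq V] in
lemma pow_eq_pow_of_cycle {π : Equiv.Perm V} {μ ν : K} {x : V → K} {a : V}
    (hx : ∀ w, π.SameCycle a w → μ * x (π w) = ν * x w) (ha : x a ≠ 0) :
    μ ^ orderOf π = ν ^ orderOf π := by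
  have key : ∀ k : ℕ, μ ^ k * x ((π ^ k) a) = ν ^ k * x a := by
    intro k
    induction k with
    | zero => simp
    | succ k ih =>
      have h1 := hx ((π ^ k) a) ⟨k, by simp⟩
      rw [pow_succ' π, Equiv.Perm.mul_apply]
      linear_combination μ ^ k * h1 + ν * ih
  have := key (orderOf π)
  rw [pow_orderOf_eq_one, Equiv.Perm.one_apply] at this
  exact mul_right_cancel₀ ha this

lemma ne_zero_on_cycle_of_source {π : Equiv.Perm V} {μ ν r : K} (hμ : μ ≠ 0) (hν : ν ≠ 0)
    (hr : r ≠ 0) {x : V → K} {a s : V} (hs : π.SameCycle a s)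
    (hx : ∀ w, π.SameCycle a w → μ * x (π w) = ν * x w + if π w = s then r else 0) :
    x a ≠ 0 := by
  intro ha
  have hs0 : x s = 0 := by
    by_contra h
    refine h (hs.symm.induction_backward (P := fun w => x w = 0) ha fun w hw h' => ?_)
    have := hx w (hs.trans hw)
    rw [h', if_neg (fun e : π w = s => h (by rw [← e, h'])), mul_zero, add_zero] at this
    exact (mul_eq_zero.1 this.symm).resolve_left hν
  have hall : ∀ b, π.SameCycle s b → x b = 0 := by
    intro b hb
    refine hb.induction_forward (P := fun w => x w = 0) hs0 fun w hw h' => ?_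
    by_cases e : π w = s
    · rw [e, hs0]
    · have := hx w (hs.trans hw)
      rw [h', if_neg e, mul_zero, add_zero] at this
      exact (mul_eq_zero.1 this).resolve_left hμ
  have hp : π.SameCycle s (π⁻¹ s) := ⟨-1, by simp⟩
  have := hx (π⁻¹ s) (hs.trans hp)
  have hinv : π (π⁻¹ s) = s := by simp
  rw [hall _ hp, hinv, hs0, if_pos rfl, mul_zero, mul_zero, zero_add] at this
  exact hr this.symm

/-- A single cycle is observable from any of its vertices. -/
lemma observableOn_cycle (π : Equiv.Perm V) (v : V) :
    ObservableOn (K := K) (fun w u => if π u = w then 1 else 0) v {w | π.SameCycle v w} := by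
  have hsum : ∀ (x : V → K) (w : V), ∑ u, (if π u = π w then (1 : K) else 0) * x u = 1 * x w := by
    intro x w
    simp
  refine ⟨fun μ x hsupp hx hne hv => hne ?_, {0}, fun μ hμ s hs r hr x _ hx => ?_⟩
  · funext w
    by_cases hw : π.SameCycle v w
    · refine eq_zero_on_cycle (μ := μ) one_ne_zero (fun w hw => ?_) hv hw
      rw [hx (π w) (Equiv.Perm.sameCycle_apply_right.2 hw), hsum]
    · exact hsupp w hw
  · refine ne_zero_on_cycle_of_source (μ := μ) (by simpa using hμ) one_ne_zero hr hs
      fun w hw => ?_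
    rw [hx (π w) (Equiv.Perm.sameCycle_apply_right.2 hw), hsum]

/-- Attach to `A` the cycle of `π` through `u₀`, with all weights `ν`, by an arc `u₀ → s₀`. -/
noncomputable def attachCycle (A : Matrix V V K) (π : Equiv.Perm V) (u₀ s₀ : V) (ν : K) :
    Matrix V V K :=
  open Classical in fun w u =>
    if π.SameCycle u₀ w then (if π u = w then ν else 0)
    else if π.SameCycle u₀ u then (if w = s₀ ∧ u = u₀ then 1 else 0)
    else A w u

lemma ObservableOn.attachCycle [IsAlgClosed K] {A : Matrix V V K} {v : V} {S : Set V}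
    (hA : ObservableOn A v S) (π : Equiv.Perm V) (hS : ∀ u w, π.SameCycle u w → w ∈ S → u ∈ S)
    {u₀ s₀ : V} (hu₀ : u₀ ∉ S) (hs₀ : s₀ ∈ S) :
    ∃ ν : K, ObservableOn (attachCycle A π u₀ s₀ ν) v (S ∪ {w | π.SameCycle u₀ w}) := by
  classical
  obtain ⟨heig, B, hB⟩ := hA
  have hL : 0 < orderOf π := orderOf_pos π
  obtain ⟨y, hy⟩ := Infinite.exists_notMem_finset (insert 0 (B.image (· ^ orderOf π)))
  obtain ⟨ν, rfl⟩ := IsAlgClosed.exists_pow_nat_eq y hL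
  have hν : ν ≠ 0 := by
    rintro rfl
    exact hy (by simp [hL.ne'])
  have hνB : ∀ μ, μ ^ orderOf π = ν ^ orderOf π → μ ∉ B := fun μ h hμ =>
    hy (Finset.mem_insert_of_mem (Finset.mem_image.2 ⟨μ, hμ, h⟩))
  have hdisj : ∀ w ∈ S, ¬ π.SameCycle u₀ w := fun w hw h => hu₀ (hS _ _ h hw)
  have hsumC : ∀ (x : V → K) (w : V), π.SameCycle u₀ w →
      ∑ u, _root_.attachCycle A π u₀ s₀ ν (π w) u * x u = ν * x w := by
    intro x w hw
    have hw' := Equiv.Perm.sameCycle_apply_right.2 hw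
    simp [_root_.attachCycle, hw]
  have hsumS : ∀ (x : V → K), (∀ w, w ∉ S ∪ {w | π.SameCycle u₀ w} → x w = 0) → ∀ w ∈ S,
      ∑ u, _root_.attachCycle A π u₀ s₀ ν w u * x u =
        ∑ u, A w u * (if u ∈ S then x u else 0) + if w = s₀ then x u₀ else 0 := by
    intro x hsupp w hw
    have : ∀ u, _root_.attachCycle A π u₀ s₀ ν w u * x u = A w u * (if u ∈ S then x u else 0) +
        if u = u₀ then (if w = s₀ then x u₀ else 0) else 0 := by
      intro u
      by_cases hu : π.SameCycle u₀ u
      · have huS : u ∉ S := fun h => hdisj u h hu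
        by_cases e : u = u₀
        · subst e
          simp [_root_.attachCycle, hdisj w hw, huS, hu]
        · simp [_root_.attachCycle, hdisj w hw, hu, huS, e]
      · have e : u ≠ u₀ := by
          rintro rfl
          exact hu (Equiv.Perm.SameCycle.refl _ _)
        by_cases huS : u ∈ S
        · simp [_root_.attachCycle, hdisj w hw, hu, huS, e]
        · simp [_root_.attachCycle, huS, e, hsupp u (by simp [hu, huS])]
    rw [Finset.sum_congr rfl fun u _ => this u, Finset.sum_add_distrib, Finset.sum_ite_eq']
    simp
  have hrestr : ∀ (x : V → K), x v = 0 → (fun u => if u ∈ S then x u else 0) v = 0 := by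
    intro x hx
    simp [hx]
  refine ⟨ν, fun μ x hsupp hx hne hv => ?_,
    B ∪ {0} ∪ (Polynomial.nthRoots (orderOf π) (ν ^ orderOf π)).toFinset,
    fun μ hμ s hs r hr x hsupp hx hv => ?_⟩
  · have hC : ∀ w, π.SameCycle u₀ w → μ * x (π w) = ν * x w := fun w hw => by
      rw [hx (π w) (Or.inr (Equiv.Perm.sameCycle_apply_right.2 hw)), hsumC x w hw]
    have hSeq : ∀ w ∈ S, μ * (if w ∈ S then x w else 0) =
        ∑ u, A w u * (if u ∈ S then x u else 0) + if w = s₀ then x u₀ else 0 := fun w hw => by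
      rw [if_pos hw, hx w (Or.inl hw), hsumS x hsupp w hw]
    by_cases h0 : x u₀ = 0
    · refine heig μ (fun u => if u ∈ S then x u else 0) (fun w hw => by simp [hw])
        (fun w hw => ?_) (fun hz => hne ?_) (hrestr x hv)
      · simpa [h0] using hSeq w hw
      · funext w
        by_cases hw : w ∈ S
        · simpa [hw] using congrFun hz w
        · by_cases hw' : π.SameCycle u₀ w
          · exact eq_zero_on_cycle hν hC h0 hw'
          · exact hsupp w (by simp [hw, hw'])
    · exact hB μ (hνB μ (pow_eq_pow_of_cycle hC h0)) s₀ hs₀ (x u₀) h0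
        (fun u => if u ∈ S then x u else 0) (fun w hw => by simp [hw]) hSeq (hrestr x hv)
  · simp only [Finset.mem_union, Finset.mem_singleton, Multiset.mem_toFinset,
      Polynomial.mem_nthRoots hL, not_or] at hμ
    obtain ⟨⟨hμB, hμ0⟩, hμν⟩ := hμ
    have hC : ∀ w, π.SameCycle u₀ w →
        μ * x (π w) = ν * x w + if π w = s then r else 0 := fun w hw => by
      rw [hx (π w) (Or.inr (Equiv.Perm.sameCycle_apply_right.2 hw)), hsumC x w hw]
    have hSeq : ∀ w ∈ S, μ * (if w ∈ S then x w else 0) =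
        ∑ u, A w u * (if u ∈ S then x u else 0) + (if w = s₀ then x u₀ else 0) +
          if w = s then r else 0 := fun w hw => by
      rw [if_pos hw, hx w (Or.inl hw), hsumS x hsupp w hw]
    by_cases hsS : s ∈ S
    · have h0 : x u₀ = 0 := by
        by_contra h0
        refine hμν (pow_eq_pow_of_cycle (fun w hw => ?_) h0)
        have hne : π w ≠ s := fun e =>
          hdisj s hsS (e ▸ Equiv.Perm.sameCycle_apply_right.2 hw)
        simpa [hne] using hC w hw
      refine hB μ hμB s hsS r hr (fun u => if u ∈ S then x u else 0)
        (fun w hw => by simp [hw]) (fun w hw => ?_) (hrestr x hv)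
      simpa [h0] using hSeq w hw
    · have h0 : x u₀ ≠ 0 := ne_zero_on_cycle_of_source hμ0 hν hr (hs.resolve_left hsS) hC
      refine hB μ hμB s₀ hs₀ (x u₀) h0 (fun u => if u ∈ S then x u else 0)
        (fun w hw => by simp [hw]) (fun w hw => ?_) (hrestr x hv)
      have hne : w ≠ s := fun e => hsS (e ▸ hw)
      simpa [hne] using hSeq w hw

omit [Fintype V] [DecidableEq V] in
lemma exists_arc_into {D : V → V → Prop} {S : Set V} {w v : V} (h : Relation.ReflTransGen D w v)
    (hw : w ∉ S) (hv : v ∈ S) : ∃ u s, u ∉ S ∧ s ∈ S ∧ D u s := by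
  induction h with
  | refl => exact absurd hv hw
  | @tail b c _ hbc ih =>
    by_cases hb : b ∈ S
    · exact ih hb
    · exact ⟨b, c, hb, hv, hbc⟩

lemma exists_observableOn_univ [IsAlgClosed K] {D : V → V → Prop}
    (hstrong : ∀ u v, Relation.ReflTransGen D u v) {π : Equiv.Perm V} (hπ : ∀ v, D v (π v))
    (v : V) : ∃ A : Matrix V V K, (∀ w u, A w u ≠ 0 → D u w) ∧ ObservableOn A v Set.univ := by
  classical
  let P : Set (Set V) := {S | v ∈ S ∧ (∀ u w, π.SameCycle u w → w ∈ S → u ∈ S) ∧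
    ∃ A : Matrix V V K, (∀ w u, A w u ≠ 0 → D u w) ∧ ObservableOn A v S}
  have hP : P.Nonempty := by
    refine ⟨{w | π.SameCycle v w}, Equiv.Perm.SameCycle.refl _ _,
      fun u w h h' => h'.trans h.symm, _, fun w u h => ?_, observableOn_cycle π v⟩
    have : π u = w := by
      by_contra e
      simp [e] at h
    exact this ▸ hπ u
  obtain ⟨S, ⟨hvS, hS, A, hAD, hA⟩, hmax⟩ := (Set.toFinite P).exists_maximal hP
  have hall : S = Set.univ := by
    by_contra hne
    obtain ⟨w, hw⟩ := (Set.ne_univ_iff_exists_notMem S).1 hne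
    obtain ⟨u₀, s₀, hu₀, hs₀, harc⟩ := exists_arc_into (hstrong w v) hw hvS
    obtain ⟨ν, hν⟩ := hA.attachCycle π hS hu₀ hs₀
    refine hu₀ (hmax ⟨Or.inl hvS, ?_, _, ?_, hν⟩ Set.subset_union_left
      (Or.inr (Equiv.Perm.SameCycle.refl _ _)))
    · rintro u w h (h' | h')
      · exact Or.inl (hS u w h h')
      · exact Or.inr (h'.trans h.symm)
    · intro w u h
      unfold attachCycle at h
      split_ifs at h with h1 h2 h3 h4
      · exact h2 ▸ hπ u
      · exact absurd rfl h
      · exact h4.1 ▸ h4.2 ▸ harc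
      · exact absurd rfl h
      · exact hAD w u h
  exact ⟨A, hAD, hall ▸ hA⟩

/-- The matrix with rows `e_v A ^ t`, for `t` less than the number of vertices. -/
def observabilityMatrix {R : Type*} [CommRing R] {n : ℕ} (A : Matrix (Fin n) (Fin n) R)
    (v : Fin n) : Matrix (Fin n) (Fin n) R :=
  fun t u => (A ^ (t : ℕ)) v u

lemma map_observabilityMatrix {R R' : Type*} [CommRing R] [CommRing R'] {n : ℕ} (φ : R →+* R')
    (A : Matrix (Fin n) (Fin n) R) (v : Fin n) :
    φ (observabilityMatrix A v).det = (observabilityMatrix (φ.mapMatrix A) v).det := by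
  rw [RingHom.map_det]
  congr 1
  ext t u
  simp only [observabilityMatrix, ← map_pow]
  rfl

lemma ObservableOn.det_ne_zero [IsAlgClosed K] {n : ℕ} {A : Matrix (Fin n) (Fin n) K} {v : Fin n}
    (hA : ObservableOn A v Set.univ) : (observabilityMatrix A v).det ≠ 0 := by
  intro hdet
  obtain ⟨x, hx0, hx⟩ := Matrix.exists_mulVec_eq_zero_iff.2 hdet
  have hlt : ∀ t < n, ((A ^ t).mulVec x) v = 0 := fun t ht => congrFun hx ⟨t, ht⟩
  let U : Submodule K (Fin n → K) :=
    ⨅ t : ℕ, LinearMap.ker ((LinearMap.proj v).comp (Matrix.mulVecLin (A ^ t)))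
  have hU : ∀ y, y ∈ U ↔ ∀ t : ℕ, ((A ^ t).mulVec y) v = 0 := by
    intro y
    simp [U, Submodule.mem_iInf]
  have hn : 0 < n := v.pos
  have hxU : x ∈ U := by
    rw [hU]
    intro t
    rw [Matrix.pow_eq_aeval_mod_charpoly, Polynomial.aeval_eq_sum_range' (n := n)]
    · rw [Matrix.sum_mulVec, Finset.sum_apply]
      refine Finset.sum_eq_zero fun i hi => ?_
      rw [Matrix.smul_mulVec, Pi.smul_apply, hlt i (Finset.mem_range.1 hi), smul_zero]
    · have h := Polynomial.natDegree_modByMonic_lt (Polynomial.X ^ t) (Matrix.charpoly_monic A)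
        (fun h1 => by
          have := Matrix.charpoly_natDegree_eq_dim A
          rw [h1] at this
          simp at this
          omega)
      simpa [Matrix.charpoly_natDegree_eq_dim] using h
  have hinv : ∀ y ∈ U, Matrix.mulVecLin A y ∈ U := by
    intro y hy
    rw [hU] at hy ⊢
    intro t
    have := hy (t + 1)
    rwa [pow_succ, ← Matrix.mulVec_mulVec] at this
  have : Nontrivial U := ⟨⟨⟨x, hxU⟩, 0, fun h => hx0 (congrArg Subtype.val h)⟩⟩
  obtain ⟨μ, hμ⟩ := Module.End.exists_eigenvalue ((Matrix.mulVecLin A).restrict hinv)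
  obtain ⟨y, hy⟩ := hμ.exists_hasEigenvector
  have hy1 : A.mulVec (y : Fin n → K) = μ • (y : Fin n → K) := congrArg Subtype.val hy.apply_eq_smul
  refine hA.eigenvector μ y (fun w hw => absurd (Set.mem_univ w) hw) (fun w _ => ?_)
    (fun h => hy.2 (Subtype.ext h)) ?_
  · exact (congrFun hy1 w).symm
  · simpa using (hU y).1 y.2 0

end Observability

section LinearNetworks

/-- The matrix supported on the arcs of `D`, with the given weights. -/
noncomputable def weightedMatrix {n : ℕ} {R : Type*} [CommRing R] (D : Fin n → Fin n → Prop)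
    (x : Fin n × Fin n → R) : Matrix (Fin n) (Fin n) R :=
  open Classical in fun w u => if D u w then x (u, w) else 0

lemma mapMatrix_weightedMatrix {n : ℕ} {R R' : Type*} [CommRing R] [CommRing R'] (φ : R →+* R')
    (D : Fin n → Fin n → Prop) (x : Fin n × Fin n → R) :
    φ.mapMatrix (weightedMatrix D x) = weightedMatrix D (fun i => φ (x i)) := by
  ext w u
  simp only [weightedMatrix, RingHom.mapMatrix_apply, Matrix.map_apply]
  split_ifs <;> simp

lemma weightedMatrix_eq {n : ℕ} {R : Type*} [CommRing R] {D : Fin n → Fin n → Prop}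
    {A : Matrix (Fin n) (Fin n) R} (hA : ∀ w u, A w u ≠ 0 → D u w) :
    weightedMatrix D (fun i => A i.2 i.1) = A := by
  ext w u
  simp only [weightedMatrix]
  split_ifs with h
  · rfl
  · by_contra h'
    exact h (hA w u (Ne.symm h'))

lemma MvPolynomial.map_ne_zero_of_eval {σ F K : Type*} [Field F] [Field K] [Algebra F K]
    {p : MvPolynomial σ ℤ} (x : σ → K) (hx : eval₂Hom (Int.castRingHom K) x p ≠ 0) :
    map (Int.castRingHom F) p ≠ 0 := by
  intro h
  apply hx
  have h' := congrArg (eval₂ (algebraMap F K) x) h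
  rw [eval₂_map, eval₂_zero] at h'
  rwa [RingHom.ext_int ((algebraMap F K).comp (Int.castRingHom F)) (Int.castRingHom K)] at h'

lemma MvPolynomial.exists_eval_ne_zero_of_totalDegree_lt {σ F : Type*} [Finite σ] [Field F]
    [Fintype F] {p : MvPolynomial σ F} (hp : p ≠ 0) (hF : p.totalDegree < Fintype.card F) :
    ∃ x : σ → F, eval x p ≠ 0 := by
  by_contra! h
  exact hp (eq_zero_of_eval_zero_at_prod_finset p (fun _ => Finset.univ)
    (fun i => (degreeOf_le_totalDegree p i).trans_lt hF) fun x _ => h x)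

/-- A polynomial in the weights of the arcs that vanishes unless all weights are nonzero, the
weighted matrix is invertible, and it is observable from every vertex. -/
noncomputable def genericPolynomial {n : ℕ} (D : Fin n → Fin n → Prop) :
    MvPolynomial (Fin n × Fin n) ℤ :=
  (∏ i, MvPolynomial.X i) * (weightedMatrix D MvPolynomial.X).det *
    ∏ v, (observabilityMatrix (weightedMatrix D MvPolynomial.X) v).det

lemma eval_genericPolynomial {n : ℕ} {R : Type*} [CommRing R] (D : Fin n → Fin n → Prop)
    (x : Fin n × Fin n → R) :
    MvPolynomial.eval₂Hom (Int.castRingHom R) x (genericPolynomial D) =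
      (∏ i, x i) * (weightedMatrix D x).det *
        ∏ v, (observabilityMatrix (weightedMatrix D x) v).det := by
  simp only [genericPolynomial, map_mul, map_prod, map_observabilityMatrix]
  simp only [RingHom.map_det, mapMatrix_weightedMatrix, MvPolynomial.eval₂Hom_X']

lemma map_genericPolynomial_ne_zero {n : ℕ} {D : Fin n → Fin n → Prop}
    (hstrong : ∀ u v : Fin n, Relation.ReflTransGen D u v)
    {π : Equiv.Perm (Fin n)} (hπ : ∀ v, D v (π v)) (F : Type*) [Field F] :
    MvPolynomial.map (Int.castRingHom F) (genericPolynomial D) ≠ 0 := by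
  simp only [genericPolynomial, map_mul, map_prod]
  refine mul_ne_zero (mul_ne_zero ?_ ?_) ?_
  · simp [Finset.prod_ne_zero_iff]
  · refine MvPolynomial.map_ne_zero_of_eval (K := F)
      (fun i => (π⁻¹).permMatrix F i.2 i.1) ?_
    rw [RingHom.map_det, mapMatrix_weightedMatrix]
    simp only [MvPolynomial.eval₂Hom_X']
    rw [weightedMatrix_eq (A := (π⁻¹).permMatrix F), Matrix.det_permutation]
    · rcases Int.units_eq_one_or (Equiv.Perm.sign π⁻¹) with h | h <;> simp [h]
    · intro w u h
      have : π u = w := by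
        by_contra e
        refine h ?_
        have e' : π⁻¹ w ≠ u := fun e' => e (by rw [← e']; simp)
        simpa [Equiv.Perm.permMatrix, PEquiv.toMatrix_apply] using e'
      exact this ▸ hπ u
  · refine Finset.prod_ne_zero_iff.2 fun v _ => ?_
    obtain ⟨A, hAD, hA⟩ := exists_observableOn_univ (K := AlgebraicClosure F) hstrong hπ v
    refine MvPolynomial.map_ne_zero_of_eval (K := AlgebraicClosure F) (fun i => A i.2 i.1) ?_
    rw [map_observabilityMatrix, mapMatrix_weightedMatrix]
    simp only [MvPolynomial.eval₂Hom_X']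
    rw [weightedMatrix_eq hAD]
    exact hA.det_ne_zero

/-- `D` is the interaction graph of an expansive network over the alphabet `α`. -/
def AdmitsExpansive {n : ℕ} (D : Fin n → Fin n → Prop) (α : Type*) : Prop :=
  ∃ f : (Fin n → α) → (Fin n → α), (∀ u v : Fin n, hasArc f u v ↔ D u v) ∧ Expansive f

lemma hasArc_mulVec {n : ℕ} {F : Type*} [Field F] (A : Matrix (Fin n) (Fin n) F) (u v : Fin n) :
    hasArc A.mulVec u v ↔ A v u ≠ 0 := by
  constructor
  · rintro ⟨a, b, hab, hne⟩ h0
    apply hne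
    simp only [Matrix.mulVec, dotProduct]
    refine (Finset.sum_congr rfl fun w _ => ?_)
    by_cases hw : w = u
    · simp [hw, h0]
    · rw [hab w hw]
  · intro h
    refine ⟨Pi.single u 1, 0, fun w hw => by simp [hw], ?_⟩
    simpa using h

lemma expansive_mulVec {n : ℕ} {F : Type*} [Field F] {A : Matrix (Fin n) (Fin n) F}
    (hdet : A.det ≠ 0) (hobs : ∀ v, (observabilityMatrix A v).det ≠ 0) : Expansive A.mulVec := by
  intro x y hxy v
  by_contra! h
  have hiter : ∀ (t : ℕ) (z : Fin n → F), A.mulVec^[t] z = (A ^ t).mulVec z := by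
    intro t
    induction t with
    | zero => simp
    | succ t ih =>
      intro z
      rw [Function.iterate_succ_apply, ih, pow_succ, Matrix.mulVec_mulVec]
  have hz : A.mulVec (x - y) = 0 := by
    refine Matrix.eq_zero_of_mulVec_eq_zero (hobs v) ?_
    funext t
    have h1 := h (t + 1) (by omega)
    rw [hiter, hiter] at h1
    change ((A ^ (t : ℕ)).mulVec (A.mulVec (x - y))) v = 0
    rw [Matrix.mulVec_mulVec, ← pow_succ, Matrix.mulVec_sub, Pi.sub_apply, h1, sub_self]
  exact hxy (sub_eq_zero.1 (Matrix.eq_zero_of_mulVec_eq_zero hdet hz))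

lemma admitsExpansive_of_field {n : ℕ} {D : Fin n → Fin n → Prop}
    (hstrong : ∀ u v : Fin n, Relation.ReflTransGen D u v)
    {π : Equiv.Perm (Fin n)} (hπ : ∀ v, D v (π v)) (F : Type*) [Field F] [Fintype F]
    (hF : (genericPolynomial D).totalDegree < Fintype.card F) : AdmitsExpansive D F := by
  have hdeg : (MvPolynomial.map (Int.castRingHom F) (genericPolynomial D)).totalDegree ≤
      (genericPolynomial D).totalDegree :=
    Finset.sup_mono (MvPolynomial.support_map_subset _ _)
  obtain ⟨x, hx⟩ := MvPolynomial.exists_eval_ne_zero_of_totalDegree_lt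
    (map_genericPolynomial_ne_zero hstrong hπ F) (hdeg.trans_lt hF)
  rw [MvPolynomial.eval_map, ← MvPolynomial.coe_eval₂Hom, eval_genericPolynomial] at hx
  have hx1 := Finset.prod_ne_zero_iff.1 (left_ne_zero_of_mul (left_ne_zero_of_mul hx))
  refine ⟨(weightedMatrix D x).mulVec, fun u v => ?_, expansive_mulVec
    (right_ne_zero_of_mul (left_ne_zero_of_mul hx))
    (fun v => Finset.prod_ne_zero_iff.1 (right_ne_zero_of_mul hx) v (Finset.mem_univ v))⟩
  rw [hasArc_mulVec]
  simp [weightedMatrix, hx1 (u, v) (Finset.mem_univ _)]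

end LinearNetworks

section Alphabets

lemma AdmitsExpansive.of_equiv {n : ℕ} {D : Fin n → Fin n → Prop} {α β : Type*} (e : α ≃ β)
    (h : AdmitsExpansive D α) : AdmitsExpansive D β := by
  obtain ⟨f, hf, hexp⟩ := h
  let g : (Fin n → β) → (Fin n → β) := fun x v => e (f (fun w => e.symm (x w)) v)
  have hsemi : Function.Semiconj (fun (x : Fin n → β) w => e.symm (x w)) g f := by
    intro x
    funext w
    simp [g]
  refine ⟨g, fun u v => (Iff.trans ?_ (hf u v)), fun x y hxy v => ?_⟩
  · constructor
    · rintro ⟨a, b, hab, hne⟩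
      exact ⟨fun w => e.symm (a w), fun w => e.symm (b w), fun w hw => by simp only [hab w hw],
        fun h => hne (congrArg e h)⟩
    · rintro ⟨a, b, hab, hne⟩
      refine ⟨fun w => e (a w), fun w => e (b w), fun w hw => by simp only [hab w hw], fun h => hne ?_⟩
      simpa [g] using h
  · obtain ⟨t, ht, hne⟩ := hexp (fun w => e.symm (x w)) (fun w => e.symm (y w)) (fun h =>
      hxy (funext fun w => e.symm.injective (congrFun h w))) v
    refine ⟨t, ht, fun h => hne ?_⟩
    rw [← (hsemi.iterate_right t).eq, ← (hsemi.iterate_right t).eq]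
    exact congrArg e.symm h

lemma AdmitsExpansive.prod {n : ℕ} {D : Fin n → Fin n → Prop} {α β : Type*} [Nonempty β]
    (hα : AdmitsExpansive D α) (hβ : AdmitsExpansive D β) : AdmitsExpansive D (α × β) := by
  obtain ⟨f, hf, hfexp⟩ := hα
  obtain ⟨g, hg, hgexp⟩ := hβ
  let h : (Fin n → α × β) → (Fin n → α × β) :=
    fun x v => (f (fun w => (x w).1) v, g (fun w => (x w).2) v)
  have hsf : Function.Semiconj (fun (x : Fin n → α × β) w => (x w).1) h f := fun _ => rfl
  have hsg : Function.Semiconj (fun (x : Fin n → α × β) w => (x w).2) h g := fun _ => rfl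
  refine ⟨h, fun u v => ⟨?_, fun hD => ?_⟩, fun x y hxy v => ?_⟩
  · rintro ⟨a, b, hab, hne⟩
    by_cases h1 : f (fun w => (a w).1) v = f (fun w => (b w).1) v
    · exact (hg u v).1 ⟨_, _, fun w hw => by rw [hab w hw], fun h2 => hne (Prod.ext h1 h2)⟩
    · exact (hf u v).1 ⟨_, _, fun w hw => by rw [hab w hw], h1⟩
  · obtain ⟨a, b, hab, hne⟩ := (hf u v).2 hD
    let c : β := Classical.arbitrary β
    exact ⟨fun w => (a w, c), fun w => (b w, c), fun w hw => by simp only [hab w hw],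
      fun h' => hne (congrArg Prod.fst h')⟩
  · by_cases h1 : (fun w => (x w).1) = fun w => (y w).1
    · have h2 : (fun w => (x w).2) ≠ fun w => (y w).2 := fun h2 =>
        hxy (funext fun w => Prod.ext (congrFun h1 w) (congrFun h2 w))
      obtain ⟨t, ht, hne⟩ := hgexp _ _ h2 v
      refine ⟨t, ht, fun h' => hne ?_⟩
      rw [← (hsg.iterate_right t).eq, ← (hsg.iterate_right t).eq]
      exact congrArg Prod.snd h'
    · obtain ⟨t, ht, hne⟩ := hfexp _ _ h1 v
      refine ⟨t, ht, fun h' => hne ?_⟩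
      rw [← (hsf.iterate_right t).eq, ← (hsf.iterate_right t).eq]
      exact congrArg Prod.fst h'

/-- An alphabet whose size has only large primary components carries an expansive network. -/
lemma admitsExpansive_fin {n : ℕ} {D : Fin n → Fin n → Prop} {N : ℕ}
    (hfield : ∀ (F : Type) [Field F] [Fintype F], N < Fintype.card F → AdmitsExpansive D F)
    (q : ℕ) (hq : 1 < q) (hlarge : ∀ p, p.Prime → p ∣ q → N < p ^ q.factorization p) :
    AdmitsExpansive D (Fin q) := by
  induction q using Nat.recOnPosPrimePosCoprime with
  | prime_pow p k hp hk =>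
    have : Fact p.Prime := ⟨hp⟩
    have hcard : Nat.card (GaloisField p k) = p ^ k := GaloisField.card p k hk.ne'
    have : Finite (GaloisField p k) := Nat.finite_of_card_ne_zero (by rw [hcard]; omega)
    have : Fintype (GaloisField p k) := Fintype.ofFinite _
    rw [Nat.card_eq_fintype_card] at hcard
    have hN := hlarge p hp (dvd_pow_self p hk.ne')
    rw [hp.factorization_pow, Finsupp.single_eq_same, ← hcard] at hN
    exact (hfield _ hN).of_equiv (Fintype.equivFinOfCardEq hcard)
  | zero => omega
  | one => omega
  | coprime a b ha hb hab iha ihb =>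
    have hfa : ∀ p, p.Prime → p ∣ a → N < p ^ a.factorization p := fun p hp hpa => by
      have := hlarge p hp (hpa.mul_right b)
      rwa [Nat.factorization_eq_of_coprime_left hab
        ((Nat.mem_primeFactorsList (by omega)).2 ⟨hp, hpa⟩)] at this
    have hfb : ∀ p, p.Prime → p ∣ b → N < p ^ b.factorization p := fun p hp hpb => by
      have := hlarge p hp (hpb.mul_left a)
      rwa [Nat.factorization_eq_of_coprime_right hab
        ((Nat.mem_primeFactorsList (by omega)).2 ⟨hp, hpb⟩)] at this
    have : Nonempty (Fin b) := ⟨⟨0, by omega⟩⟩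
    exact ((iha ha hfa).prod (ihb hb hfb)).of_equiv finProdFinEquiv

lemma lt_pow_factorization_of_factorial_dvd {N q p : ℕ} (hq : 0 < q)
    (hdvd : (N + 2).factorial ^ (N + 2) ∣ q) (hp : p.Prime) (hpq : p ∣ q) :
    N < p ^ q.factorization p := by
  by_cases hpN : p ≤ N + 2
  · have h1 : p ^ (N + 2) ∣ q :=
      (pow_dvd_pow_of_dvd (Nat.dvd_factorial hp.pos hpN) _).trans hdvd
    have h2 : N + 2 ≤ q.factorization p := (hp.pow_dvd_iff_le_factorization hq.ne').1 h1
    have h3 : q.factorization p < p ^ q.factorization p := Nat.lt_pow_self hp.one_lt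
    omega
  · have h2 : 1 ≤ q.factorization p := (hp.dvd_iff_one_le_factorization hq.ne').1 hpq
    have h3 : p ^ 1 ≤ p ^ q.factorization p := Nat.pow_le_pow_right hp.pos h2
    rw [pow_one] at h3
    omega

end Alphabets

/-- Corollary: for every strong and coverable directed graph `D` on `n ≥ 2` vertices
there is a positive integer `Q` such that for every positive multiple `q` of `Q` there
exists an expansive automata network over the alphabet `[q]` whose interaction graph
is `D`; in particular the set of such alphabet sizes has positive density. -/
theorem stmt_7 (n : ℕ) (hn : 2 ≤ n) (D : Fin n → Fin n → Prop)
    (hstrong : ∀ u v : Fin n, Relation.ReflTransGen D u v)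
    (hcov : ∃ π : Equiv.Perm (Fin n), ∀ v : Fin n, D v (π v)) :
    ∃ Q : ℕ, 0 < Q ∧ ∀ q : ℕ, 0 < q → Q ∣ q →
      ∃ f : (Fin n → Fin q) → (Fin n → Fin q),
        (∀ u v : Fin n, hasArc f u v ↔ D u v) ∧ Expansive f := by
  obtain ⟨π, hπ⟩ := hcov
  let N := (genericPolynomial D).totalDegree
  refine ⟨(N + 2).factorial ^ (N + 2), pow_pos (Nat.factorial_pos _) _, fun q hq hdvd => ?_⟩
  have hQ : 1 < (N + 2).factorial ^ (N + 2) :=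
    Nat.one_lt_pow (by omega) (Nat.one_lt_factorial.2 (by omega))
  exact admitsExpansive_fin (N := N) (fun F _ _ => admitsExpansive_of_field hstrong hπ F) q
    (hQ.trans_le (Nat.le_of_dvd hq hdvd))
    fun p hp hpq => lt_pow_factorization_of_factorial_dvd hq hdvd hp hpq
end
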